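/- arXiv:2310.00663 — 2 statements merged into one kernel-verified Lean document; each statement's English description precedes it below -/
import Mathlib

section
/- Let S be a countably based, left-soft separative, (2,ω)-divisible Cu-semigroup satisfying (O5), (O6) and (O7), and assume in addition that S is almost unperforated. Then the map σ: S → S, sending x to the supremum of L_x (the largest strongly soft element below x), is additive: σ(x+y) = σ(x) + σ(y) for all x,y ∈ S. -/
open Set

/-- The way-below relation: `x ≪ y` if for every increasing sequence with a
supremum dominating `y`, some term of the sequence dominates `x`. -/
def WayBelow {S : Type*} [Preorder S] (x y : S) : Prop :=
  ∀ z : ℕ → S, Monotone z → ∀ s : S, IsLUB (Set.range z) s → y ≤ s → ∃ m : ℕ, x ≤ z m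

/-- A Cu-semigroup: a positively ordered commutative monoid satisfying (O1)-(O4). -/
class CuSemigroup (S : Type*) extends AddCommMonoid S, PartialOrder S where
  zero_le : ∀ x : S, 0 ≤ x
  add_mono : ∀ {a b c d : S}, a ≤ b → c ≤ d → a + c ≤ b + d
  O1 : ∀ z : ℕ → S, Monotone z → ∃ s : S, IsLUB (Set.range z) s
  O2 : ∀ x : S, ∃ z : ℕ → S, (∀ n, WayBelow (z n) (z (n + 1))) ∧ IsLUB (Set.range z) x
  O3 : ∀ {x' x y' y : S}, WayBelow x' x → WayBelow y' y → WayBelow (x' + y') (x + y)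
  O4 : ∀ (x y : ℕ → S), Monotone x → Monotone y → ∀ sx sy : S,
      IsLUB (Set.range x) sx → IsLUB (Set.range y) sy →
      IsLUB (Set.range fun n => x n + y n) (sx + sy)

variable {S : Type*}

lemma CuSemigroup.nsmul_mono [CuSemigroup S] (x : S) : Monotone fun n : ℕ => n • x := by
  intro n m h
  obtain ⟨k, rfl⟩ := Nat.exists_eq_add_of_le h
  show n • x ≤ (n + k) • x
  rw [add_nsmul]
  calc n • x = n • x + 0 := by rw [add_zero]
    _ ≤ n • x + k • x := CuSemigroup.add_mono le_rfl (CuSemigroup.zero_le _)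

/-- `infty x` is the supremum of the increasing sequence `n • x`, i.e. `∞x`. -/
noncomputable def infty [CuSemigroup S] (x : S) : S :=
  (CuSemigroup.O1 (fun n : ℕ => n • x) (CuSemigroup.nsmul_mono x)).choose

lemma infty_isLUB [CuSemigroup S] (x : S) :
    IsLUB (Set.range fun n : ℕ => n • x) (infty x) :=
  (CuSemigroup.O1 (fun n : ℕ => n • x) (CuSemigroup.nsmul_mono x)).choose_spec

/-- An element is strongly soft if every `x' ≪ x` admits `t` with `x' + t ≪ x`
and `x' ≪ ∞t`. -/
def StronglySoft [CuSemigroup S] (x : S) : Prop :=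
  ∀ x' : S, WayBelow x' x → ∃ t : S, WayBelow (x' + t) x ∧ WayBelow x' (infty t)

def SatisfiesO5 (S : Type*) [CuSemigroup S] : Prop :=
  ∀ x' x y' y z : S, WayBelow x' x → WayBelow y' y → x + y ≤ z →
    ∃ c : S, WayBelow y' c ∧ x' + c ≤ z ∧ z ≤ x + c

def SatisfiesO6 (S : Type*) [CuSemigroup S] : Prop :=
  ∀ x' x y z : S, WayBelow x' x → WayBelow x (y + z) →
    ∃ v w : S, v ≤ x ∧ v ≤ y ∧ w ≤ x ∧ w ≤ z ∧ x' ≤ v + w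

def SatisfiesO7 (S : Type*) [CuSemigroup S] : Prop :=
  ∀ x' x y' y w : S, WayBelow x' x → x ≤ w → WayBelow y' y → y ≤ w →
    ∃ z : S, WayBelow x' z ∧ WayBelow y' z ∧ z ≤ w ∧ z ≤ x + y

def TwoOmegaDivisible (S : Type*) [CuSemigroup S] : Prop :=
  ∀ x' x : S, WayBelow x' x → ∃ y : S, 2 • y ≤ x ∧ x' ≤ infty y

def WeaklyCancellative (S : Type*) [CuSemigroup S] : Prop :=
  ∀ x y z : S, WayBelow (x + z) (y + z) → WayBelow x y

def Separative (S : Type*) [CuSemigroup S] : Prop :=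
  ∀ x y t : S, WayBelow (x + t) (y + t) → WayBelow t (infty x) → WayBelow t (infty y) →
    WayBelow x y

def LeftSoftSeparative (S : Type*) [CuSemigroup S] : Prop :=
  ∀ x y t : S, StronglySoft x → WayBelow (x + t) (y + t) → WayBelow t (infty x) →
    WayBelow t (infty y) → WayBelow x y

def AlmostUnperforated (S : Type*) [CuSemigroup S] : Prop :=
  ∀ x y : S, (∃ n : ℕ, 1 ≤ n ∧ (n + 1) • x ≤ n • y) → x ≤ y

def CountablyBased (S : Type*) [CuSemigroup S] : Prop :=
  ∃ D : Set S, D.Countable ∧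
    ∀ x : S, ∃ z : ℕ → S, Monotone z ∧ (∀ n, z n ∈ D) ∧ IsLUB (Set.range z) x

/-- `Lset x` is the set `L_x = { u' : u' ≪ u ≪ x for some strongly soft u }`. -/
def Lset [CuSemigroup S] (x : S) : Set S :=
  { u' | ∃ u : S, StronglySoft u ∧ WayBelow u' u ∧ WayBelow u x }

/-- A functional on a Cu-semigroup: a monoid morphism to `[0,∞]` preserving order
and suprema of increasing sequences. -/
structure CuFunctional (S : Type*) [CuSemigroup S] where
  toFun : S → ENNReal
  map_zero : toFun 0 = 0
  map_add : ∀ x y : S, toFun (x + y) = toFun x + toFun y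
  mono : ∀ x y : S, x ≤ y → toFun x ≤ toFun y
  map_sup : ∀ z : ℕ → S, Monotone z → ∀ s : S, IsLUB (Set.range z) s →
    toFun s = ⨆ n, toFun (z n)

/-- Predicate version: `f : S → [0,∞]` is a functional on `S`. -/
def IsCuFunctional [CuSemigroup S] (f : S → ENNReal) : Prop :=
  f 0 = 0 ∧ (∀ x y : S, f (x + y) = f x + f y) ∧ (∀ x y : S, x ≤ y → f x ≤ f y) ∧
  (∀ z : ℕ → S, Monotone z → ∀ s : S, IsLUB (Set.range z) s → f s = ⨆ n, f (z n))

/-- Least upper bound of `A` computed within the subset `T`. -/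
def IsLUBIn [CuSemigroup S] (T : Set S) (A : Set S) (s : S) : Prop :=
  s ∈ T ∧ s ∈ upperBounds A ∧ ∀ b ∈ T, b ∈ upperBounds A → s ≤ b

/-- The way-below relation computed within the subset `T`. -/
def WayBelowIn [CuSemigroup S] (T : Set S) (x y : S) : Prop :=
  ∀ z : ℕ → S, Monotone z → (∀ n, z n ∈ T) → ∀ s : S, IsLUBIn T (Set.range z) s → y ≤ s →
    ∃ m : ℕ, x ≤ z m

/-- `T` is a sub-Cu-semigroup of `S`: a submonoid which is itself a Cu-semigroup
for the inherited order, such that the inclusion preserves suprema of increasing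
sequences and the way-below relation. -/
structure IsSubCuSemigroup [CuSemigroup S] (T : Set S) : Prop where
  zero_mem : (0 : S) ∈ T
  add_mem : ∀ {x y : S}, x ∈ T → y ∈ T → x + y ∈ T
  o1 : ∀ z : ℕ → S, Monotone z → (∀ n, z n ∈ T) → ∃ s : S, IsLUBIn T (Set.range z) s
  o2 : ∀ x ∈ T, ∃ z : ℕ → S, (∀ n, z n ∈ T) ∧ (∀ n, WayBelowIn T (z n) (z (n + 1))) ∧
        IsLUBIn T (Set.range z) x
  o3 : ∀ {x' x y' y : S}, x' ∈ T → x ∈ T → y' ∈ T → y ∈ T →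
        WayBelowIn T x' x → WayBelowIn T y' y → WayBelowIn T (x' + y') (x + y)
  o4 : ∀ (x y : ℕ → S), Monotone x → Monotone y → (∀ n, x n ∈ T) → (∀ n, y n ∈ T) →
        ∀ sx sy : S, IsLUBIn T (Set.range x) sx → IsLUBIn T (Set.range y) sy →
        IsLUBIn T (Set.range fun n => x n + y n) (sx + sy)
  incl_sup : ∀ z : ℕ → S, Monotone z → (∀ n, z n ∈ T) → ∀ s : S,
        IsLUBIn T (Set.range z) s → IsLUB (Set.range z) s
  incl_wayBelow : ∀ {x y : S}, x ∈ T → y ∈ T → WayBelowIn T x y → WayBelow x y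

def SatisfiesO5In [CuSemigroup S] (T : Set S) : Prop :=
  ∀ x' x y' y z : S, x' ∈ T → x ∈ T → y' ∈ T → y ∈ T → z ∈ T →
    WayBelowIn T x' x → WayBelowIn T y' y → x + y ≤ z →
    ∃ c ∈ T, WayBelowIn T y' c ∧ x' + c ≤ z ∧ z ≤ x + c

def SatisfiesO6In [CuSemigroup S] (T : Set S) : Prop :=
  ∀ x' x y z : S, x' ∈ T → x ∈ T → y ∈ T → z ∈ T →
    WayBelowIn T x' x → WayBelowIn T x (y + z) →
    ∃ v ∈ T, ∃ w ∈ T, v ≤ x ∧ v ≤ y ∧ w ≤ x ∧ w ≤ z ∧ x' ≤ v + w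

def SatisfiesO7In [CuSemigroup S] (T : Set S) : Prop :=
  ∀ x' x y' y w : S, x' ∈ T → x ∈ T → y' ∈ T → y ∈ T → w ∈ T →
    WayBelowIn T x' x → x ≤ w → WayBelowIn T y' y → y ≤ w →
    ∃ z ∈ T, WayBelowIn T x' z ∧ WayBelowIn T y' z ∧ z ≤ w ∧ z ≤ x + y

/-- `f` is a functional on the sub-Cu-semigroup `T` (values off `T` are irrelevant). -/
def IsFunctionalOn [CuSemigroup S] (T : Set S) (f : S → ENNReal) : Prop :=
  f 0 = 0 ∧
  (∀ x ∈ T, ∀ y ∈ T, f (x + y) = f x + f y) ∧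
  (∀ x ∈ T, ∀ y ∈ T, x ≤ y → f x ≤ f y) ∧
  (∀ z : ℕ → S, Monotone z → (∀ n, z n ∈ T) → ∀ s : S, IsLUBIn T (Set.range z) s →
    f s = ⨆ n, f (z n))

/-- An element is full if `x ≤ ∞e` for every `x`. -/
def IsFull [CuSemigroup S] (e : S) : Prop := ∀ x : S, x ≤ infty e

/-- Condition (R1) for `r`: comparison of `x` with `y` whenever
`λ(x) + r·λ(e) ≤ λ(y)` for all functionals. -/
def SatisfiesR1 (S : Type*) [CuSemigroup S] (e : S) (r : NNReal) : Prop :=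
  ∀ x y : S,
    (∀ lam : CuFunctional S, lam.toFun x + (r : ENNReal) * lam.toFun e ≤ lam.toFun y) → x ≤ y

/-- The radius of comparison of `(S, e)`. -/
noncomputable def rc (S : Type*) [CuSemigroup S] (e : S) : ENNReal :=
  ⨅ r ∈ {r : NNReal | 0 < r ∧ SatisfiesR1 S e r}, (r : ENNReal)

/-- Condition (R1) for the sub-Cu-semigroup `T`. -/
def SatisfiesR1On [CuSemigroup S] (T : Set S) (e : S) (r : NNReal) : Prop :=
  ∀ x ∈ T, ∀ y ∈ T,
    (∀ f : S → ENNReal, IsFunctionalOn T f → f x + (r : ENNReal) * f e ≤ f y) → x ≤ y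

/-- The radius of comparison of `(T, e)` for a sub-Cu-semigroup `T ⊆ S`. -/
noncomputable def rcOn [CuSemigroup S] (T : Set S) (e : S) : ENNReal :=
  ⨅ r ∈ {r : NNReal | 0 < r ∧ SatisfiesR1On T e r}, (r : ENNReal)

/-- `dim S ≤ n` in the sense of covering dimension of Cu-semigroups. -/
def DimLe (S : Type*) [CuSemigroup S] (n : ℕ) : Prop :=
  ∀ (x' x : S) (r : ℕ) (y : Fin r → S), WayBelow x' x → WayBelow x (∑ j, y j) →
    ∃ z : Fin r → Fin (n + 1) → S,
      (∀ j k, WayBelow (z j k) (y j)) ∧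
      WayBelow x' (∑ j, ∑ k, z j k) ∧
      (∀ k, WayBelow (∑ j, z j k) x)

/-- The covering dimension of a Cu-semigroup, in `ℕ ∪ {∞}`. -/
noncomputable def cuDim (S : Type*) [CuSemigroup S] : ℕ∞ :=
  ⨅ n ∈ {n : ℕ | DimLe S n}, (n : ℕ∞)

/-- `dim T ≤ n` for a sub-Cu-semigroup `T ⊆ S`. -/
def DimLeOn [CuSemigroup S] (T : Set S) (n : ℕ) : Prop :=
  ∀ (x' x : S), x' ∈ T → x ∈ T → ∀ (r : ℕ) (y : Fin r → S), (∀ j, y j ∈ T) →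
    WayBelowIn T x' x → WayBelowIn T x (∑ j, y j) →
    ∃ z : Fin r → Fin (n + 1) → S,
      (∀ j k, z j k ∈ T) ∧
      (∀ j k, WayBelowIn T (z j k) (y j)) ∧
      WayBelowIn T x' (∑ j, ∑ k, z j k) ∧
      (∀ k, WayBelowIn T (∑ j, z j k) x)

/-- The covering dimension of a sub-Cu-semigroup `T ⊆ S`. -/
noncomputable def cuDimOn [CuSemigroup S] (T : Set S) : ℕ∞ :=
  ⨅ n ∈ {n : ℕ | DimLeOn T n}, (n : ℕ∞)

namespace CuSemigroup

instance isOrderedAddMonoid {S : Type*} [CuSemigroup S] : IsOrderedAddMonoid S where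
  add_le_add_left _ _ h _ := CuSemigroup.add_mono h le_rfl

section WayBelow

variable {S : Type*} [CuSemigroup S]

lemma wayBelow_le {x y : S} (h : WayBelow x y) : x ≤ y := by
  obtain ⟨_, hm⟩ := h (fun _ => y) monotone_const y (by simp) le_rfl
  exact hm

lemma wayBelow_of_le_of_wayBelow {x y z : S} (h : x ≤ y) (h' : WayBelow y z) :
    WayBelow x z := by
  intro w hw s hs hle
  obtain ⟨m, hm⟩ := h' w hw s hs hle
  exact ⟨m, h.trans hm⟩

lemma wayBelow_of_wayBelow_of_le {x y z : S} (h : WayBelow x y) (h' : y ≤ z) :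
    WayBelow x z :=
  fun w hw s hs hle => h w hw s hs (h'.trans hle)

lemma zero_wayBelow (x : S) : WayBelow 0 x :=
  fun z _ _ _ _ => ⟨0, CuSemigroup.zero_le (z 0)⟩

/-- Every element is the supremum of a monotone, rapidly increasing sequence of elements
way-below it. -/
lemma exists_rapid (x : S) : ∃ z : ℕ → S, Monotone z ∧ (∀ n, WayBelow (z n) (z (n + 1))) ∧
    (∀ n, WayBelow (z n) x) ∧ IsLUB (Set.range z) x := by
  obtain ⟨z, hz, hlub⟩ := CuSemigroup.O2 x
  exact ⟨z, monotone_nat_of_le_succ fun n => wayBelow_le (hz n), hz,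
    fun n => wayBelow_of_wayBelow_of_le (hz n) (hlub.1 ⟨n + 1, rfl⟩), hlub⟩

lemma exists_wayBelow_between {x y : S} (h : WayBelow x y) :
    ∃ z, WayBelow x z ∧ WayBelow z y := by
  obtain ⟨z, hmono, hz, hzy, hlub⟩ := exists_rapid y
  obtain ⟨m, hm⟩ := h z hmono y hlub le_rfl
  exact ⟨z (m + 1), wayBelow_of_le_of_wayBelow hm (hz m), hzy _⟩

lemma exists_wayBelow_upper_bound {x y z : S} (hx : WayBelow x z) (hy : WayBelow y z) :
    ∃ w, WayBelow w z ∧ x ≤ w ∧ y ≤ w := by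
  obtain ⟨a, hmono, -, ha, hlub⟩ := exists_rapid z
  obtain ⟨m, hm⟩ := hx a hmono z hlub le_rfl
  obtain ⟨n, hn⟩ := hy a hmono z hlub le_rfl
  exact ⟨a (max m n), ha _, hm.trans (hmono (le_max_left _ _)),
    hn.trans (hmono (le_max_right _ _))⟩

lemma exists_wayBelow_add {x y z : S} (h : WayBelow x (y + z)) :
    ∃ y' z', WayBelow y' y ∧ WayBelow z' z ∧ x ≤ y' + z' := by
  obtain ⟨a, hamono, -, ha, halub⟩ := exists_rapid y
  obtain ⟨b, hbmono, -, hb, hblub⟩ := exists_rapid z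
  obtain ⟨m, hm⟩ := h _ (hamono.add hbmono) _ (CuSemigroup.O4 a b hamono hbmono y z halub hblub)
    le_rfl
  exact ⟨a m, b m, ha m, hb m, hm⟩

lemma nsmul_wayBelow_nsmul {x y : S} (h : WayBelow x y) (n : ℕ) :
    WayBelow (n • x) (n • y) := by
  induction n with
  | zero => simpa using zero_wayBelow (0 : S)
  | succ n ih => simpa only [succ_nsmul] using CuSemigroup.O3 ih h

lemma exists_wayBelow_nsmul {x y : S} (n : ℕ) (h : WayBelow x (n • y)) :
    ∃ y', WayBelow y' y ∧ x ≤ n • y' := by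
  induction n generalizing x with
  | zero => exact ⟨0, zero_wayBelow y, by simpa using wayBelow_le h⟩
  | succ n ih =>
    rw [succ_nsmul] at h
    obtain ⟨a, b, ha, hb, hx⟩ := exists_wayBelow_add h
    obtain ⟨a', ha', haa'⟩ := ih ha
    obtain ⟨c, hc, hac, hbc⟩ := exists_wayBelow_upper_bound ha' hb
    refine ⟨c, hc, hx.trans ?_⟩
    rw [succ_nsmul]
    exact add_le_add (haa'.trans (nsmul_le_nsmul_right hac n)) hbc

lemma nsmul_le_infty (n : ℕ) (x : S) : n • x ≤ infty x :=
  (infty_isLUB x).1 ⟨n, rfl⟩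

lemma exists_le_nsmul_of_wayBelow_infty {x y : S} (h : WayBelow x (infty y)) :
    ∃ n : ℕ, x ≤ n • y :=
  h _ (CuSemigroup.nsmul_mono y) _ (infty_isLUB y) le_rfl

lemma nsmul_le_nsmul_of_le {m n : ℕ} (h : m ≤ n) (x : S) : m • x ≤ n • x :=
  CuSemigroup.nsmul_mono x h

lemma le_add_right_self (x y : S) : x ≤ x + y :=
  le_add_of_nonneg_right (CuSemigroup.zero_le y)

lemma le_add_left_self (x y : S) : x ≤ y + x :=
  le_add_of_nonneg_left (CuSemigroup.zero_le y)

end WayBelow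

section Soft

variable {S : Type*} [CuSemigroup S]

lemma _root_.StronglySoft.add {x y : S} (hx : StronglySoft x) (hy : StronglySoft y) :
    StronglySoft (x + y) := by
  intro a ha
  obtain ⟨b, hab, hb⟩ := exists_wayBelow_between ha
  obtain ⟨x', y', hx', hy', hle⟩ := exists_wayBelow_add hb
  obtain ⟨t, ht, hxt⟩ := hx x' hx'
  obtain ⟨u, hu, hyu⟩ := hy y' hy'
  obtain ⟨m, hm⟩ := exists_le_nsmul_of_wayBelow_infty hxt
  obtain ⟨n, hn⟩ := exists_le_nsmul_of_wayBelow_infty hyu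
  refine ⟨t + u, wayBelow_of_le_of_wayBelow ?_ (CuSemigroup.O3 ht hu),
    wayBelow_of_wayBelow_of_le hab ?_⟩
  · calc a + (t + u) ≤ (x' + y') + (t + u) := by
          gcongr; exact (wayBelow_le hab).trans hle
      _ = (x' + t) + (y' + u) := by abel
  · calc b ≤ x' + y' := hle
      _ ≤ m • t + n • u := add_le_add hm hn
      _ ≤ max m n • t + max m n • u :=
          add_le_add (nsmul_le_nsmul_of_le (le_max_left _ _) _)
            (nsmul_le_nsmul_of_le (le_max_right _ _) _)
      _ = max m n • (t + u) := (nsmul_add _ _ _).symm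
      _ ≤ infty (t + u) := nsmul_le_infty _ _

/-- A strongly soft element absorbs elements dominated by one of its multiples. -/
lemma _root_.StronglySoft.add_of_le_nsmul {s c : S} (hs : StronglySoft s) {m : ℕ} (hc : c ≤ m • s) :
    StronglySoft (s + c) := by
  intro a ha
  obtain ⟨b, hab, hb⟩ := exists_wayBelow_between ha
  obtain ⟨s₁, c', hs₁, hc', hle⟩ := exists_wayBelow_add hb
  obtain ⟨s₂, hs₂, hcs₂⟩ := exists_wayBelow_nsmul m (wayBelow_of_wayBelow_of_le hc' hc)
  obtain ⟨s₃, hs₃, h₁, h₂⟩ := exists_wayBelow_upper_bound hs₁ hs₂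
  obtain ⟨t, ht, hst⟩ := hs s₃ hs₃
  obtain ⟨n, hn⟩ := exists_le_nsmul_of_wayBelow_infty hst
  refine ⟨t, wayBelow_of_le_of_wayBelow ?_ (CuSemigroup.O3 ht hc'),
    wayBelow_of_wayBelow_of_le hab ?_⟩
  · calc a + t ≤ (s₁ + c') + t := by
          gcongr; exact (wayBelow_le hab).trans hle
      _ ≤ (s₃ + c') + t := by gcongr
      _ = s₃ + t + c' := by abel
  · calc b ≤ s₁ + c' := hle
      _ ≤ s₃ + m • s₃ := add_le_add h₁ (hcs₂.trans (nsmul_le_nsmul_right h₂ m))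
      _ = (m + 1) • s₃ := by rw [succ_nsmul, add_comm]
      _ ≤ (m + 1) • (n • t) := nsmul_le_nsmul_right hn _
      _ = ((m + 1) * n) • t := (mul_nsmul' _ _ _).symm
      _ ≤ infty t := nsmul_le_infty _ _

lemma _root_.StronglySoft.exists_succ_nsmul_le {u u' : S} (hu : StronglySoft u) (h : WayBelow u' u) :
    ∃ n : ℕ, 1 ≤ n ∧ ∃ u'', WayBelow u'' u ∧ (n + 1) • u' ≤ n • u'' := by
  obtain ⟨t, ht, hut⟩ := hu u' h
  obtain ⟨n, hn⟩ := exists_le_nsmul_of_wayBelow_infty hut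
  refine ⟨n + 1, by omega, u' + t, ht, ?_⟩
  rw [succ_nsmul _ (n + 1), nsmul_add]
  gcongr
  exact hn.trans (nsmul_le_nsmul_of_le n.le_succ t)

/-- Comparison in almost unperforated semigroups up to arbitrarily small multiplicative error. -/
lemma _root_.AlmostUnperforated.le_of_nsmul_le (hau : AlmostUnperforated S) {a b c : S} {n N : ℕ}
    (hn : 1 ≤ n) (hN : n + 1 ≤ N) (hab : (n + 1) • a ≤ n • b)
    (hbc : N • b ≤ (N + 1) • c) : a ≤ c := by
  refine hau a c ⟨n * (N + 1), Nat.mul_pos hn N.succ_pos, ?_⟩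
  calc (n * (N + 1) + 1) • a ≤ (N * (n + 1)) • a := nsmul_le_nsmul_of_le (by nlinarith) a
    _ = N • ((n + 1) • a) := mul_nsmul' _ _ _
    _ ≤ N • (n • b) := nsmul_le_nsmul_right hab N
    _ = n • (N • b) := by rw [← mul_nsmul', ← mul_nsmul', mul_comm]
    _ ≤ n • ((N + 1) • c) := nsmul_le_nsmul_right hbc n
    _ = (n * (N + 1)) • c := (mul_nsmul' _ _ _).symm

end Soft

section Divisible

variable {S : Type*} [CuSemigroup S]

lemma _root_.TwoOmegaDivisible.exists_half (hdiv : TwoOmegaDivisible S) {x' x : S}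
    (h : WayBelow x' x) :
    ∃ y' y : S, WayBelow y' y ∧ y + y ≤ x ∧ ∃ m : ℕ, x' ≤ m • y' := by
  obtain ⟨x₁, h₁, hx₁⟩ := exists_wayBelow_between h
  obtain ⟨x₂, h₂, hx₂⟩ := exists_wayBelow_between h₁
  obtain ⟨y, hy, hle⟩ := hdiv x₁ x hx₁
  obtain ⟨m, hm⟩ := exists_le_nsmul_of_wayBelow_infty (wayBelow_of_wayBelow_of_le hx₂ hle)
  obtain ⟨y', hy', hxy⟩ := exists_wayBelow_nsmul m (wayBelow_of_wayBelow_of_le h₂ hm)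
  exact ⟨y', y, hy', by rwa [two_nsmul] at hy, m, hxy⟩

lemma _root_.TwoOmegaDivisible.exists_pow (hdiv : TwoOmegaDivisible S) {x' x : S}
    (h : WayBelow x' x) (j : ℕ) :
    ∃ y' y : S, WayBelow y' y ∧ 2 ^ j • y ≤ x ∧ ∃ m : ℕ, x' ≤ m • y' := by
  induction j with
  | zero => exact ⟨x', x, h, by simp, 1, by simp⟩
  | succ j ih =>
    obtain ⟨y', y, hy, hyx, m, hm⟩ := ih
    obtain ⟨z', z, hz, hzy, n, hn⟩ := hdiv.exists_half hy
    refine ⟨z', z, hz, ?_, m * n, ?_⟩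
    · calc 2 ^ (j + 1) • z = 2 ^ j • (z + z) := by rw [pow_succ, mul_nsmul', two_nsmul]
        _ ≤ 2 ^ j • y := nsmul_le_nsmul_right hzy _
        _ ≤ x := hyx
    · calc x' ≤ m • y' := hm
        _ ≤ m • (n • z') := nsmul_le_nsmul_right hn m
        _ = (m * n) • z' := (mul_nsmul' _ _ _).symm

lemma _root_.TwoOmegaDivisible.exists_stronglySoft (hdiv : TwoOmegaDivisible S) {x' x : S}
    (h : WayBelow x' x) :
    ∃ r : S, StronglySoft r ∧ r ≤ x ∧ ∃ m : ℕ, x' ≤ m • r := by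
  have hstep (p : {p : S × S // WayBelow p.1 p.2}) : ∃ q : {p : S × S // WayBelow p.1 p.2},
      q.1.2 + q.1.2 ≤ p.1.2 ∧ ∃ m : ℕ, p.1.1 ≤ m • q.1.1 := by
    obtain ⟨y', y, hy, hle, hm⟩ := hdiv.exists_half p.2
    exact ⟨⟨(y', y), hy⟩, hle, hm⟩
  choose next hhalf hdom using hstep
  let p : ℕ → {p : S × S // WayBelow p.1 p.2} := fun n => next^[n] ⟨(x', x), h⟩
  have hp (n : ℕ) : p (n + 1) = next (p n) := Function.iterate_succ_apply' ..
  let A : ℕ → S := fun n => ∑ i ∈ Finset.range n, (p (i + 1)).1.1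
  have hA (n : ℕ) : A (n + 1) = A n + (p (n + 1)).1.1 := Finset.sum_range_succ ..
  have hAmono : Monotone A := monotone_nat_of_le_succ fun n => by
    rw [hA]; exact le_add_right_self _ _
  have hAx (n : ℕ) : A n + (p n).1.2 ≤ x := by
    induction n with
    | zero => simp [A, p]
    | succ n ih =>
      refine le_trans ?_ ih
      rw [hA, add_assoc]
      gcongr
      have := hhalf (p n)
      rw [← hp] at this
      exact (add_le_add_left (wayBelow_le (p (n + 1)).2) _).trans this
  have hAdom (n : ℕ) : ∃ m : ℕ, A n ≤ m • (p (n + 1)).1.1 := by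
    induction n with
    | zero => exact ⟨0, by simp [A]⟩
    | succ n ih =>
      obtain ⟨m, hm⟩ := ih
      obtain ⟨k, hk⟩ := hdom (p (n + 1))
      rw [← hp] at hk
      refine ⟨(m + 1) * k, ?_⟩
      calc A (n + 1) ≤ m • (p (n + 1)).1.1 + (p (n + 1)).1.1 := by rw [hA]; gcongr
        _ = (m + 1) • (p (n + 1)).1.1 := (succ_nsmul _ _).symm
        _ ≤ (m + 1) • (k • (p (n + 1 + 1)).1.1) := nsmul_le_nsmul_right hk _
        _ = _ := (mul_nsmul' _ _ _).symm
  obtain ⟨r, hr⟩ := CuSemigroup.O1 A hAmono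
  refine ⟨r, ?_, hr.2 ?_, ?_⟩
  · intro a ha
    obtain ⟨b, hab, hb⟩ := exists_wayBelow_between ha
    obtain ⟨c, hbc, hc⟩ := exists_wayBelow_between hb
    obtain ⟨n, hn⟩ := hc A hAmono r hr le_rfl
    obtain ⟨m, hm⟩ := hAdom n
    obtain ⟨t, ht, hbt⟩ :=
      exists_wayBelow_nsmul m (wayBelow_of_wayBelow_of_le hbc (hn.trans hm))
    refine ⟨t, wayBelow_of_wayBelow_of_le
      (CuSemigroup.O3 (wayBelow_of_wayBelow_of_le hab (wayBelow_le hbc)) ht) ?_,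
      wayBelow_of_wayBelow_of_le hab (hbt.trans (nsmul_le_infty m t))⟩
    calc c + (p (n + 1)).1.1 ≤ A n + (p (n + 1)).1.1 := by gcongr
      _ = A (n + 1) := (hA n).symm
      _ ≤ r := hr.1 ⟨n + 1, rfl⟩
  · rintro _ ⟨n, rfl⟩
    exact (le_add_right_self _ _).trans (hAx n)
  · obtain ⟨m, hm⟩ := hdom (p 0)
    refine ⟨m, hm.trans (nsmul_le_nsmul_right ?_ m)⟩
    rw [← hp]
    refine le_trans ?_ (hr.1 ⟨1, rfl⟩)
    simp [A]

end Divisible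

section Approximation

variable {S : Type*} [CuSemigroup S]

/-- Up to small multiplicative error, elements way-below `x` are dominated by strongly soft
elements below `x`. -/
lemma exists_stronglySoft_nsmul_le (hdiv : TwoOmegaDivisible S) (hO5 : SatisfiesO5 S)
    (hO6 : SatisfiesO6 S) (hO7 : SatisfiesO7 S) {x' x : S} (h : WayBelow x' x) (N : ℕ) :
    ∃ a : S, StronglySoft a ∧ a ≤ x ∧ N • x' ≤ (N + 1) • a := by
  obtain ⟨x₀, hx₀, h₀⟩ := exists_wayBelow_between h
  obtain ⟨x₁, hx₁, h₁⟩ := exists_wayBelow_between h₀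
  obtain ⟨y', y, hy, hyx, m, hm⟩ := hdiv.exists_pow h₁ N
  obtain ⟨s₁, hys₁, hs₁y⟩ := exists_wayBelow_between hy
  obtain ⟨s₂, hs, hs₂y⟩ := exists_wayBelow_between hs₁y
  obtain ⟨r, hr, hrs₁, n, hn⟩ := hdiv.exists_stronglySoft hys₁
  have hsum : s₂ + N • y ≤ x := by
    calc s₂ + N • y ≤ y + N • y := by gcongr; exact wayBelow_le hs₂y
      _ = (N + 1) • y := by rw [succ_nsmul, add_comm]
      _ ≤ 2 ^ N • y := nsmul_le_nsmul_of_le N.lt_two_pow_self y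
      _ ≤ x := hyx
  obtain ⟨c, hNc, hcx, hxc⟩ := hO5 s₁ s₂ (N • s₂) (N • y) x hs (nsmul_wayBelow_nsmul hs₂y N) hsum
  obtain ⟨v, w, hvx, hvs, hwx, hwc, hvw⟩ :=
    hO6 x₀ x₁ s₂ c hx₁ (wayBelow_of_wayBelow_of_le h₁ hxc)
  obtain ⟨v', w', hv', hw', hvw'⟩ := exists_wayBelow_add (wayBelow_of_wayBelow_of_le hx₀ hvw)
  obtain ⟨z, hvz, hwz, hzc, hzvw⟩ := hO7 (N • v') (N • v) w' w c (nsmul_wayBelow_nsmul hv' N)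
    ((nsmul_le_nsmul_right hvs N).trans (wayBelow_le hNc)) hw' hwc
  have hzr : z ≤ ((N + 1) * m * n) • r := by
    calc z ≤ N • v + w := hzvw
      _ ≤ N • x₁ + x₁ := by gcongr
      _ = (N + 1) • x₁ := (succ_nsmul _ _).symm
      _ ≤ (N + 1) • (m • (n • r)) :=
          nsmul_le_nsmul_right (hm.trans (nsmul_le_nsmul_right hn m)) _
      _ = ((N + 1) * m * n) • r := by rw [mul_nsmul', mul_nsmul']
  refine ⟨r + z, hr.add_of_le_nsmul hzr, (add_le_add hrs₁ hzc).trans hcx, ?_⟩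
  calc N • x' ≤ N • (v' + w') := nsmul_le_nsmul_right hvw' N
    _ = N • v' + N • w' := nsmul_add _ _ _
    _ ≤ z + N • z := add_le_add (wayBelow_le hvz) (nsmul_le_nsmul_right (wayBelow_le hwz) N)
    _ = (N + 1) • z := by rw [succ_nsmul, add_comm]
    _ ≤ (N + 1) • (r + z) := nsmul_le_nsmul_right (le_add_left_self _ _) _

lemma Lset_mono {x y : S} (h : x ≤ y) : Lset x ⊆ Lset y := fun _ ⟨u, hu, hu'u, hux⟩ =>
  ⟨u, hu, hu'u, wayBelow_of_wayBelow_of_le hux h⟩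

lemma add_mem_Lset {x y a b : S} (ha : a ∈ Lset x) (hb : b ∈ Lset y) :
    a + b ∈ Lset (x + y) := by
  obtain ⟨u, hu, hau, hux⟩ := ha
  obtain ⟨v, hv, hbv, hvy⟩ := hb
  exact ⟨u + v, hu.add hv, CuSemigroup.O3 hau hbv, CuSemigroup.O3 hux hvy⟩

lemma exists_mem_Lset_nsmul_le (hdiv : TwoOmegaDivisible S) (hO5 : SatisfiesO5 S)
    (hO6 : SatisfiesO6 S) (hO7 : SatisfiesO7 S) {x' x : S} (h : WayBelow x' x) (N : ℕ) :
    ∃ b ∈ Lset x, N • x' ≤ (N + 1) • b := by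
  obtain ⟨x₂, h₂, hx₂⟩ := exists_wayBelow_between h
  obtain ⟨x₁, h₁, hx₁⟩ := exists_wayBelow_between h₂
  obtain ⟨a, ha, hax, hle⟩ := exists_stronglySoft_nsmul_le hdiv hO5 hO6 hO7 hx₁ N
  obtain ⟨b, hb, hxb⟩ := exists_wayBelow_nsmul (N + 1)
    (wayBelow_of_wayBelow_of_le (nsmul_wayBelow_nsmul h₁ N) hle)
  exact ⟨b, ⟨a, ha, hb, wayBelow_of_le_of_wayBelow hax hx₂⟩, hxb⟩

lemma directedOn_Lset (hdiv : TwoOmegaDivisible S) (hO5 : SatisfiesO5 S)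
    (hO6 : SatisfiesO6 S) (hO7 : SatisfiesO7 S) (hau : AlmostUnperforated S) (x : S) :
    DirectedOn (· ≤ ·) (Lset x) := by
  rintro u' ⟨u, hu, hu'u, hux⟩ v' ⟨v, hv, hv'v, hvx⟩
  obtain ⟨m, hm, u₁, hu₁, hum⟩ := hu.exists_succ_nsmul_le hu'u
  obtain ⟨n, hn, v₁, hv₁, hvn⟩ := hv.exists_succ_nsmul_le hv'v
  obtain ⟨z, huz, hvz, hzx, -⟩ :=
    hO7 u₁ u v₁ v x hu₁ (wayBelow_le hux) hv₁ (wayBelow_le hvx)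
  obtain ⟨z', hz', huz', hvz'⟩ := exists_wayBelow_upper_bound huz hvz
  obtain ⟨b, hb, hle⟩ := exists_mem_Lset_nsmul_le hdiv hO5 hO6 hO7 hz' (max m n + 1)
  exact ⟨b, Lset_mono hzx hb,
    hau.le_of_nsmul_le hm (by omega) (hum.trans (nsmul_le_nsmul_right huz' m)) hle,
    hau.le_of_nsmul_le hn (by omega) (hvn.trans (nsmul_le_nsmul_right hvz' n)) hle⟩

lemma exists_monotone_cofinal_Lset (hdiv : TwoOmegaDivisible S) (hO5 : SatisfiesO5 S)
    (hO6 : SatisfiesO6 S) (hO7 : SatisfiesO7 S) (hau : AlmostUnperforated S) (x : S) :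
    ∃ a : ℕ → S, Monotone a ∧ (∀ n, a n ∈ Lset x) ∧ ∀ u ∈ Lset x, ∃ n, u ≤ a n := by
  obtain ⟨z, hzmono, -, hzx, hlub⟩ := exists_rapid x
  choose b hb hzb using fun n => exists_mem_Lset_nsmul_le hdiv hO5 hO6 hO7 (hzx n) n
  choose g hg hg₁ hg₂ using directedOn_Lset hdiv hO5 hO6 hO7 hau x
  let a : ℕ → Lset x := fun n =>
    Nat.rec ⟨b 0, hb 0⟩ (fun n c => ⟨g c c.2 (b (n + 1)) (hb (n + 1)), hg ..⟩) n
  have hba (n : ℕ) : b n ≤ (a n).1 := by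
    cases n with
    | zero => exact le_rfl
    | succ n => exact hg₂ ..
  refine ⟨fun n => (a n).1, monotone_nat_of_le_succ fun n => hg₁ .., fun n => (a n).2, ?_⟩
  rintro u' ⟨u, hu, hu'u, hux⟩
  obtain ⟨n, hn, u₁, hu₁, hle⟩ := hu.exists_succ_nsmul_le hu'u
  obtain ⟨k, hk⟩ := hux z hzmono x hlub le_rfl
  refine ⟨max k (n + 1), le_trans ?_ (hba _)⟩
  refine hau.le_of_nsmul_le hn (le_max_right k _) (hle.trans (nsmul_le_nsmul_right ?_ n)) (hzb _)
  exact (wayBelow_le hu₁).trans (hk.trans (hzmono (le_max_left _ _)))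

lemma exists_monotone_Lset_isLUB (hdiv : TwoOmegaDivisible S) (hO5 : SatisfiesO5 S)
    (hO6 : SatisfiesO6 S) (hO7 : SatisfiesO7 S) (hau : AlmostUnperforated S) {x s : S}
    (hs : IsLUB (Lset x) s) :
    ∃ a : ℕ → S, Monotone a ∧ (∀ n, a n ∈ Lset x) ∧ IsLUB (Set.range a) s := by
  obtain ⟨a, hmono, hmem, hcof⟩ := exists_monotone_cofinal_Lset hdiv hO5 hO6 hO7 hau x
  refine ⟨a, hmono, hmem, ?_, fun b hb => hs.2 fun u hu => ?_⟩
  · rintro _ ⟨n, rfl⟩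
    exact hs.1 (hmem n)
  · obtain ⟨n, hn⟩ := hcof u hu
    exact hn.trans (hb ⟨n, rfl⟩)

end Approximation

end CuSemigroup

open CuSemigroup

/-- In a countably based, left-soft separative, (2,ω)-divisible,
almost unperforated Cu-semigroup satisfying (O5)-(O7), the map `σ` is additive. -/
theorem sigma_additive_of_almostUnperforated {S : Type*} [CuSemigroup S]
    (hcb : CountablyBased S) (hsep : LeftSoftSeparative S)
    (hdiv : TwoOmegaDivisible S)
    (hO5 : SatisfiesO5 S) (hO6 : SatisfiesO6 S) (hO7 : SatisfiesO7 S)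
    (hau : AlmostUnperforated S)
    (sigma : S → S) (hsigma : ∀ x : S, IsLUB (Lset x) (sigma x)) :
    ∀ x y : S, sigma (x + y) = sigma x + sigma y := by
  intro x y
  apply le_antisymm
  · refine (hsigma (x + y)).2 ?_
    rintro u' ⟨u, hu, hu'u, huxy⟩
    obtain ⟨n, hn, u₁, hu₁, hle⟩ := StronglySoft.exists_succ_nsmul_le hu hu'u
    obtain ⟨x', y', hx', hy', huxy'⟩ := exists_wayBelow_add huxy
    obtain ⟨b, hb, hxb⟩ := exists_mem_Lset_nsmul_le hdiv hO5 hO6 hO7 hx' (n + 1)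
    obtain ⟨c, hc, hyc⟩ := exists_mem_Lset_nsmul_le hdiv hO5 hO6 hO7 hy' (n + 1)
    refine le_trans ?_ (add_le_add ((hsigma x).1 hb) ((hsigma y).1 hc))
    refine AlmostUnperforated.le_of_nsmul_le hau hn le_rfl
      (hle.trans (nsmul_le_nsmul_right ((wayBelow_le hu₁).trans huxy') n)) ?_
    rw [nsmul_add, nsmul_add]
    exact add_le_add hxb hyc
  · obtain ⟨a, ha, hax, halub⟩ := exists_monotone_Lset_isLUB hdiv hO5 hO6 hO7 hau (hsigma x)
    obtain ⟨b, hb, hby, hblub⟩ := exists_monotone_Lset_isLUB hdiv hO5 hO6 hO7 hau (hsigma y)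
    refine (CuSemigroup.O4 a b ha hb _ _ halub hblub).2 ?_
    rintro _ ⟨n, rfl⟩
    exact (hsigma (x + y)).1 (add_mem_Lset (hax n) (hby n))
end

section
/- Let S be a countably based, left-soft separative, (2,ω)-divisible Cu-semigroup satisfying (O5), (O6) and (O7), and assume that the map σ: S → S_soft, sending x to the largest strongly soft element below x, is a generalized Cu-morphism (i.e. additive, order-preserving, and preserving suprema of increasing sequences). Then dim(S_soft) ≤ dim(S) ≤ dim(S_soft) + 1. -/
open Set

variable {S : Type*}

instance CuSemigroup.isOrderedAddMonoid_s19 [CuSemigroup S] : IsOrderedAddMonoid S where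
  add_le_add_left _ _ h c := CuSemigroup.add_mono h (le_refl c)

section WayBelow

variable [CuSemigroup S] {x x' y y' z w t : S}

theorem WayBelow.le (h : WayBelow x y) : x ≤ y := by
  obtain ⟨_, hm⟩ := h (fun _ => y) monotone_const y (by simp) le_rfl
  exact hm

theorem WayBelow.trans_le (h : WayBelow x y) (h' : y ≤ z) : WayBelow x z :=
  fun a ha s hs hz => h a ha s hs (h'.trans hz)

theorem WayBelow.le_trans (h : x ≤ y) (h' : WayBelow y z) : WayBelow x z := by
  intro a ha s hs hz
  obtain ⟨m, hm⟩ := h' a ha s hs hz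
  exact ⟨m, h.trans hm⟩

theorem WayBelow.trans (h : WayBelow x y) (h' : WayBelow y z) : WayBelow x z :=
  h.trans_le h'.le

theorem zero_wayBelow (x : S) : WayBelow 0 x :=
  fun _ _ _ _ _ => ⟨0, CuSemigroup.zero_le _⟩

theorem exists_wayBelow_seq (x : S) : ∃ z : ℕ → S, Monotone z ∧
    (∀ n, WayBelow (z n) (z (n + 1))) ∧ (∀ n, WayBelow (z n) x) ∧ IsLUB (range z) x := by
  obtain ⟨z, hz, hx⟩ := CuSemigroup.O2 x
  exact ⟨z, monotone_nat_of_le_succ fun n => (hz n).le, hz,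
    fun n => (hz n).trans_le (hx.1 ⟨n + 1, rfl⟩), hx⟩

theorem WayBelow.exists_between (h : WayBelow x' x) :
    ∃ y, WayBelow x' y ∧ WayBelow y x := by
  obtain ⟨z, hm, hs, hb, hl⟩ := exists_wayBelow_seq x
  obtain ⟨n, hn⟩ := h z hm x hl le_rfl
  exact ⟨z (n + 1), WayBelow.le_trans hn (hs n), hb _⟩

theorem WayBelow.exists_common (h : WayBelow x' x) (h' : WayBelow y' x) :
    ∃ y, WayBelow x' y ∧ WayBelow y' y ∧ WayBelow y x := by
  obtain ⟨z, hm, hs, hb, hl⟩ := exists_wayBelow_seq x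
  obtain ⟨n, hn⟩ := h z hm x hl le_rfl
  obtain ⟨m, hm'⟩ := h' z hm x hl le_rfl
  refine ⟨z (max n m + 1), ?_, ?_, hb _⟩
  · exact WayBelow.le_trans (hn.trans (hm (le_max_left n m))) (hs _)
  · exact WayBelow.le_trans (hm'.trans (hm (le_max_right n m))) (hs _)

theorem le_of_forall_wayBelow (h : ∀ x', WayBelow x' x → x' ≤ y) : x ≤ y := by
  obtain ⟨z, -, -, hb, hl⟩ := exists_wayBelow_seq x
  exact hl.2 (by rintro _ ⟨n, rfl⟩; exact h _ (hb n))

theorem WayBelow.exists_add (h : WayBelow w (x + y)) :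
    ∃ x' y', WayBelow x' x ∧ WayBelow y' y ∧ WayBelow w (x' + y') := by
  obtain ⟨w₂, h₁, h₂⟩ := h.exists_between
  obtain ⟨a, am, -, ab, al⟩ := exists_wayBelow_seq x
  obtain ⟨b, bm, -, bb, bl⟩ := exists_wayBelow_seq y
  obtain ⟨n, hn⟩ := h₂ _ (am.add bm) _ (CuSemigroup.O4 a b am bm x y al bl) le_rfl
  exact ⟨a n, b n, ab n, bb n, h₁.trans_le hn⟩

theorem WayBelow.exists_sum {r : ℕ} {y : Fin r → S} (h : WayBelow w (∑ j, y j)) :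
    ∃ y' : Fin r → S, (∀ j, WayBelow (y' j) (y j)) ∧ WayBelow w (∑ j, y' j) := by
  induction r generalizing w with
  | zero => exact ⟨y, fun j => j.elim0, h⟩
  | succ r ih =>
    rw [Fin.sum_univ_succ] at h
    obtain ⟨a, b, ha, hb, hw⟩ := h.exists_add
    obtain ⟨y', hy', hb'⟩ := ih hb
    refine ⟨Fin.cons a y', Fin.cases ha hy', ?_⟩
    rw [Fin.sum_univ_succ]
    exact hw.trans_le (add_le_add le_rfl hb'.le)

theorem nsmul_le_infty (n : ℕ) (x : S) : n • x ≤ infty x :=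
  (infty_isLUB x).1 ⟨n, rfl⟩

theorem le_infty (x : S) : x ≤ infty x := by
  simpa using nsmul_le_infty 1 x

theorem infty_add_self (x : S) : infty x + infty x = infty x := by
  refine le_antisymm ?_ (le_add_of_nonneg_right (CuSemigroup.zero_le _))
  refine (CuSemigroup.O4 _ _ (CuSemigroup.nsmul_mono x) (CuSemigroup.nsmul_mono x) _ _
    (infty_isLUB x) (infty_isLUB x)).2 ?_
  rintro _ ⟨n, rfl⟩
  simpa only [← add_nsmul] using nsmul_le_infty (n + n) x

theorem add_le_infty (hx : x ≤ infty z) (hy : y ≤ infty z) : x + y ≤ infty z :=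
  (add_le_add hx hy).trans (infty_add_self z).le

theorem nsmul_le_infty_of_le (hx : x ≤ infty z) (n : ℕ) : n • x ≤ infty z := by
  induction n with
  | zero => simpa using CuSemigroup.zero_le (infty z)
  | succ n ih => rw [succ_nsmul]; exact add_le_infty ih hx

theorem infty_le_infty (hx : x ≤ infty z) : infty x ≤ infty z :=
  (infty_isLUB x).2 (by rintro _ ⟨n, rfl⟩; exact nsmul_le_infty_of_le hx n)

theorem infty_mono (hx : x ≤ z) : infty x ≤ infty z :=
  infty_le_infty (hx.trans (le_infty z))

theorem isLUB_nsmul {z : ℕ → S} (hz : Monotone z) (hx : IsLUB (range z) x) (n : ℕ) :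
    IsLUB (range fun k => n • z k) (n • x) := by
  induction n with
  | zero => simp
  | succ n ih =>
    simp only [succ_nsmul]
    exact CuSemigroup.O4 _ _ (fun i j h => nsmul_le_nsmul_right (hz h) n) hz _ _ ih hx

theorem WayBelow.exists_infty (h : WayBelow w (infty y)) :
    ∃ y', WayBelow y' y ∧ WayBelow w (infty y') := by
  obtain ⟨w₂, h₁, h₂⟩ := h.exists_between
  obtain ⟨w₃, h₃, h₄⟩ := h₂.exists_between
  obtain ⟨n, hn⟩ := h₄ _ (CuSemigroup.nsmul_mono y) _ (infty_isLUB y) le_rfl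
  obtain ⟨z, hm, -, hb, hl⟩ := exists_wayBelow_seq y
  obtain ⟨k, hk⟩ := h₃ _ (fun i j h => nsmul_le_nsmul_right (hm h) n) _
    (isLUB_nsmul hm hl n) hn
  exact ⟨z k, hb k, h₁.trans_le (hk.trans (nsmul_le_infty n _))⟩

theorem exists_O6_sum (hO6 : SatisfiesO6 S) {r : ℕ} {y : Fin r → S}
    (h : WayBelow x' x) (hx : WayBelow x (∑ j, y j)) :
    ∃ v : Fin r → S, (∀ j, v j ≤ x) ∧ (∀ j, v j ≤ y j) ∧ x' ≤ ∑ j, v j := by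
  induction r generalizing x' x with
  | zero => exact ⟨y, fun j => j.elim0, fun j => j.elim0, h.le.trans hx.le⟩
  | succ r ih =>
    rw [Fin.sum_univ_succ] at hx
    obtain ⟨x₁, h₁, h₂⟩ := h.exists_between
    obtain ⟨v, w, hvx, hvy, hwx, hwy, hvw⟩ := hO6 x₁ x _ _ h₂ hx
    obtain ⟨v', w', hv', hw', hx'⟩ := (h₁.trans_le hvw).exists_add
    obtain ⟨w₁, hw₁, hw₂⟩ := hw'.exists_between
    obtain ⟨u, hux, huy, hu⟩ := ih hw₁ (hw₂.trans_le hwy)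
    refine ⟨Fin.cons v u, Fin.cases hvx fun j => (hux j).trans (hw₂.le.trans hwx),
      Fin.cases hvy huy, ?_⟩
    rw [Fin.sum_univ_succ]
    exact hx'.le.trans (add_le_add hv'.le hu)

theorem exists_O7_sum (hO7 : SatisfiesO7 S) {r : ℕ} {a a' : Fin r → S}
    (h : ∀ j, WayBelow (a' j) (a j)) (hw : ∀ j, a j ≤ w) :
    ∃ z, (∀ j, a' j ≤ z) ∧ z ≤ w ∧ z ≤ ∑ j, a j := by
  suffices H : ∃ z' z, WayBelow z' z ∧ (∀ j, a' j ≤ z') ∧ z ≤ w ∧ z ≤ ∑ j, a j by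
    obtain ⟨z', z, hz, ha, hzw, hza⟩ := H
    exact ⟨z, fun j => (ha j).trans hz.le, hzw, hza⟩
  induction r with
  | zero => exact ⟨0, 0, zero_wayBelow 0, fun j => j.elim0, CuSemigroup.zero_le _, by simp⟩
  | succ r ih =>
    obtain ⟨z', z, hz, ha, hzw, hza⟩ := ih (fun j => h j.succ) (fun j => hw j.succ)
    obtain ⟨u, hu₁, hu₂, huw, hu⟩ := hO7 _ _ _ _ w (h 0) (hw 0) hz hzw
    obtain ⟨u', hu₁', hu₂', hu'⟩ := hu₁.exists_common hu₂
    refine ⟨u', u, hu', Fin.cases hu₁'.le fun j => (ha j).trans hu₂'.le, huw, ?_⟩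
    rw [Fin.sum_univ_succ]
    exact hu.trans (add_le_add le_rfl hza)

theorem TwoOmegaDivisible.exists_pow_s19 (hdiv : TwoOmegaDivisible S) (N : ℕ)
    (h : WayBelow x' x) : ∃ y : S, 2 ^ N • y ≤ x ∧ x' ≤ infty y := by
  induction N generalizing x' with
  | zero => exact ⟨x, by simp, h.le.trans (le_infty x)⟩
  | succ N ih =>
    obtain ⟨x₁, h₁, h₂⟩ := h.exists_between
    obtain ⟨y, hy, hxy⟩ := ih h₂
    obtain ⟨y', hy', hxy'⟩ := (h₁.trans_le hxy).exists_infty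
    obtain ⟨z, hz, hyz⟩ := hdiv y' y hy'
    refine ⟨z, ?_, hxy'.le.trans (infty_le_infty hyz)⟩
    rw [pow_succ, mul_nsmul']
    exact (nsmul_le_nsmul_right hz _).trans hy

end WayBelow

section Soft

variable [CuSemigroup S] {x x' y u u' v v' t w : S}

theorem StronglySoft.zero : StronglySoft (0 : S) := by
  intro x' hx'
  exact ⟨0, by simpa using hx', hx'.trans_le (CuSemigroup.zero_le _)⟩

theorem StronglySoft.add_left (ht : StronglySoft t) (hx : x ≤ infty t) :
    StronglySoft (x + t) := by
  intro w hw
  obtain ⟨x₁, t₁, hx₁, ht₁, hw₁⟩ := hw.exists_add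
  obtain ⟨t₂, ht₂, hxt₂⟩ := (hx₁.trans_le hx).exists_infty
  obtain ⟨t₃, h₁₃, h₂₃, ht₃⟩ := ht₁.exists_common ht₂
  obtain ⟨s, hs, hts⟩ := ht t₃ ht₃
  refine ⟨s, ?_, hw₁.trans_le (add_le_infty ?_ (h₁₃.le.trans hts.le))⟩
  · have h := CuSemigroup.O3 hx₁ hs
    rw [← add_assoc] at h
    exact WayBelow.le_trans
      (add_le_add (hw₁.le.trans (add_le_add le_rfl h₁₃.le)) le_rfl) h
  · exact hxt₂.le.trans (infty_le_infty (h₂₃.le.trans hts.le))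

theorem TwoOmegaDivisible.exists_step (hdiv : TwoOmegaDivisible S) (h : WayBelow x' x) :
    ∃ y' y : S, WayBelow y' y ∧ y + y ≤ x ∧ x' ≤ infty y' := by
  obtain ⟨x₁, h₁, h₂⟩ := h.exists_between
  obtain ⟨y, hy, hxy⟩ := hdiv x₁ x h₂
  obtain ⟨y', hy', hxy'⟩ := (h₁.trans_le hxy).exists_infty
  exact ⟨y', y, hy', by rwa [← two_nsmul], hxy'.le⟩

/-- The supremum of the partial sums of a sequence whose terms eventually generate all the
earlier ones is strongly soft. -/
theorem stronglySoft_of_isLUB_sum {a : ℕ → S} (ha : ∀ n, a n ≤ infty (a (n + 1)))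
    (hx : IsLUB (range fun n => ∑ i ∈ Finset.range n, a i) x) : StronglySoft x := by
  have hmono : Monotone fun n => ∑ i ∈ Finset.range n, a i :=
    monotone_nat_of_le_succ fun n => by
      rw [Finset.sum_range_succ]
      exact le_add_of_nonneg_right (CuSemigroup.zero_le _)
  have hsum : ∀ n, ∑ i ∈ Finset.range n, a i ≤ infty (a n) := by
    intro n
    induction n with
    | zero => simpa using CuSemigroup.zero_le (infty (a 0))
    | succ n ih =>
      rw [Finset.sum_range_succ]
      exact add_le_infty (ih.trans (infty_le_infty (ha n))) (ha n)
  intro w hw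
  obtain ⟨w₁, h₁, h₂⟩ := hw.exists_between
  obtain ⟨n, hn⟩ := h₂ _ hmono _ hx le_rfl
  obtain ⟨t, ht, hwt⟩ := (h₁.trans_le (hn.trans (hsum n))).exists_infty
  refine ⟨t, (CuSemigroup.O3 (h₁.trans_le hn) ht).trans_le ?_, hwt⟩
  exact hx.1 ⟨n + 1, Finset.sum_range_succ a n⟩

theorem TwoOmegaDivisible.exists_soft (hdiv : TwoOmegaDivisible S) (h : WayBelow x' x) :
    ∃ y : S, StronglySoft y ∧ y ≤ x ∧ x' ≤ infty y := by
  have hstep : ∀ p : {p : S × S // WayBelow p.1 p.2}, ∃ q : {p : S × S // WayBelow p.1 p.2},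
      q.1.2 + q.1.2 ≤ p.1.2 ∧ p.1.1 ≤ infty q.1.1 := by
    rintro ⟨⟨a', a⟩, ha⟩
    obtain ⟨b', b, hb, hba, hab⟩ := hdiv.exists_step ha
    exact ⟨⟨(b', b), hb⟩, hba, hab⟩
  choose f hf₁ hf₂ using hstep
  let q : ℕ → {p : S × S // WayBelow p.1 p.2} := fun n => f^[n] ⟨(x', x), h⟩
  have hq : ∀ n, q (n + 1) = f (q n) := fun n => Function.iterate_succ_apply' f n _
  let a : ℕ → S := fun n => (q (n + 1)).1.1
  have hbound : ∀ n, ∑ i ∈ Finset.range n, a i + (q n).1.2 ≤ x := by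
    intro n
    induction n with
    | zero => simp [q]
    | succ n ih =>
      rw [Finset.sum_range_succ, add_assoc]
      refine (add_le_add le_rfl ?_).trans ih
      refine (add_le_add (q (n + 1)).2.le le_rfl).trans ?_
      rw [hq]
      exact hf₁ (q n)
  have ha : ∀ n, (q n).1.1 ≤ infty (q (n + 1)).1.1 := fun n => by
    rw [hq]; exact hf₂ (q n)
  have hmono : Monotone fun n => ∑ i ∈ Finset.range n, a i :=
    monotone_nat_of_le_succ fun n => by
      rw [Finset.sum_range_succ]
      exact le_add_of_nonneg_right (CuSemigroup.zero_le _)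
  obtain ⟨s, hs⟩ := CuSemigroup.O1 _ hmono
  refine ⟨s, stronglySoft_of_isLUB_sum (fun n => ha (n + 1)) hs, hs.2 ?_, ?_⟩
  · rintro _ ⟨n, rfl⟩
    exact (le_add_of_nonneg_right (CuSemigroup.zero_le _)).trans (hbound n)
  · refine (ha 0).trans (infty_mono (hs.1 ⟨1, ?_⟩))
    simp [a]

theorem TwoOmegaDivisible.exists_soft_of_infty (hdiv : TwoOmegaDivisible S)
    (h : WayBelow w (infty x)) : ∃ y : S, StronglySoft y ∧ y ≤ x ∧ w ≤ infty y := by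
  obtain ⟨x', hx', hw⟩ := h.exists_infty
  obtain ⟨y, hy, hyx, hxy⟩ := hdiv.exists_soft hx'
  exact ⟨y, hy, hyx, hw.le.trans (infty_le_infty hxy)⟩

theorem TwoOmegaDivisible.exists_soft_pow (hdiv : TwoOmegaDivisible S) (N : ℕ)
    (h : WayBelow x' x) : ∃ y : S, StronglySoft y ∧ 2 ^ N • y ≤ x ∧ x' ≤ infty y := by
  obtain ⟨x₁, h₁, h₂⟩ := h.exists_between
  obtain ⟨z, hz, hxz⟩ := hdiv.exists_pow_s19 N h₂
  obtain ⟨y, hy, hyz, hxy⟩ := hdiv.exists_soft_of_infty (h₁.trans_le hxz)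
  exact ⟨y, hy, (nsmul_le_nsmul_right hyz _).trans hz, hxy⟩

theorem StronglySoft.exists_soft_add (hdiv : TwoOmegaDivisible S) (hu : StronglySoft u)
    (h : WayBelow u' u) : ∃ t : S, StronglySoft t ∧ WayBelow (u' + t) u ∧ u' ≤ infty t := by
  obtain ⟨t, ht, hut⟩ := hu u' h
  obtain ⟨s, hs, hst, hus⟩ := hdiv.exists_soft_of_infty hut
  exact ⟨s, hs, WayBelow.le_trans (add_le_add le_rfl hst) ht, hus⟩

theorem StronglySoft.exists_between (hdiv : TwoOmegaDivisible S) (hu : StronglySoft u)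
    (h : WayBelow u' u) : ∃ v : S, StronglySoft v ∧ WayBelow u' v ∧ WayBelow v u := by
  obtain ⟨u₁, h₁, h₂⟩ := h.exists_between
  obtain ⟨t, ht, hut, hu₁⟩ := hu.exists_soft_add hdiv h₂
  exact ⟨u₁ + t, ht.add_left hu₁,
    h₁.trans_le (le_add_of_nonneg_right (CuSemigroup.zero_le _)), hut⟩

/-- A strongly soft element below `x` can be enlarged, up to way-below, to one that generates
a prescribed part of the ideal generated by `x`. -/
theorem StronglySoft.exists_full (hdiv : TwoOmegaDivisible S) (hO5 : SatisfiesO5 S)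
    (hv : StronglySoft v) (h : WayBelow v' v) (hvx : v ≤ x) (hx : WayBelow x' x) :
    ∃ w : S, StronglySoft w ∧ w ≤ x ∧ WayBelow v' w ∧ x' ≤ infty w := by
  obtain ⟨v₁, h₁, h₁v⟩ := h.exists_between
  obtain ⟨v₂, h₁₂, h₂v⟩ := h₁v.exists_between
  obtain ⟨t, ht, hvt⟩ := hv v₂ h₂v
  obtain ⟨t', ht', hvt'⟩ := hvt.exists_infty
  obtain ⟨c, hc, hcx, hxc⟩ := hO5 v₁ v₂ t' t x h₁₂ ht' (ht.le.trans hvx)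
  have hxc' : x ≤ infty c :=
    hxc.trans (add_le_infty (hvt'.le.trans (infty_mono hc.le)) (le_infty c))
  obtain ⟨x₁, hx₁, hvx₁, hx₁x⟩ := hx.exists_common (h₁v.trans_le hvx)
  obtain ⟨s, hs, hsc, hxs⟩ := hdiv.exists_soft_of_infty (hx₁x.trans_le hxc')
  refine ⟨v₁ + s, hs.add_left (hvx₁.le.trans hxs), (add_le_add le_rfl hsc).trans hcx,
    h₁.trans_le (le_add_of_nonneg_right (CuSemigroup.zero_le _)), ?_⟩
  refine hx₁.le.trans (hxs.trans (infty_mono ?_))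
  exact le_add_of_nonneg_left (CuSemigroup.zero_le _)

theorem TwoOmegaDivisible.exists_le_le (hdiv : TwoOmegaDivisible S) (hO6 : SatisfiesO6 S)
    (hO7 : SatisfiesO7 S) (h : WayBelow x' x) (hy : x ≤ infty y) :
    ∃ z : S, z ≤ x ∧ z ≤ y ∧ x' ≤ infty z := by
  obtain ⟨x₀, h₀, h₀x⟩ := h.exists_between
  obtain ⟨M, hM⟩ := (h₀x.trans_le hy) _ (CuSemigroup.nsmul_mono y) _ (infty_isLUB y) le_rfl
  obtain ⟨x₁, h₁, h₁₀⟩ := h₀.exists_between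
  obtain ⟨p, hp, hxp⟩ := hdiv.exists_pow_s19 M h₁₀
  obtain ⟨p₁, hp₁, hxp₁⟩ := (h₁.trans_le hxp).exists_infty
  obtain ⟨p₂, hp₁₂, hp₂⟩ := hp₁.exists_between
  obtain ⟨p₃, hp₂₃, hp₃⟩ := hp₂.exists_between
  have hpx : ∀ n ≤ 2 ^ M, n • p ≤ x₀ := fun n hn => (CuSemigroup.nsmul_mono p hn).trans hp
  have hpy : p ≤ ∑ _j : Fin M, y := by
    have := (hpx 1 Nat.one_le_two_pow).trans hM
    simpa using this
  obtain ⟨a, hap, hay, ha⟩ := exists_O6_sum hO6 hp₂₃ (hp₃.trans_le hpy)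
  obtain ⟨a', ha', hpa⟩ := (hp₁₂.trans_le ha).exists_sum
  obtain ⟨z, haz, hzy, hza⟩ := exists_O7_sum hO7 ha' hay
  refine ⟨z, ?_, hzy, hxp₁.le.trans (infty_le_infty ?_)⟩
  · calc z ≤ ∑ j, a j := hza
      _ ≤ ∑ _j : Fin M, p := Finset.sum_le_sum fun j _ => (hap j).trans hp₃.le
      _ = M • p := by simp
      _ ≤ x := (hpx M Nat.lt_two_pow_self.le).trans h₀x.le
  · calc p₁ ≤ ∑ j, a' j := hpa.le
      _ ≤ ∑ _j : Fin M, z := Finset.sum_le_sum fun j _ => haz j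
      _ = M • z := by simp
      _ ≤ infty z := nsmul_le_infty M z

/-- The set `Lset x` is upward directed. -/
theorem LeftSoftSeparative.exists_soft_common (hsep : LeftSoftSeparative S)
    (hdiv : TwoOmegaDivisible S) (hO5 : SatisfiesO5 S) (hO6 : SatisfiesO6 S)
    (hO7 : SatisfiesO7 S) (hu : StronglySoft u) (hv : StronglySoft v)
    (huu : WayBelow u' u) (hux : WayBelow u x) (hvv : WayBelow v' v) (hvx : WayBelow v x) :
    ∃ w : S, StronglySoft w ∧ WayBelow u' w ∧ WayBelow v' w ∧ WayBelow w x := by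
  obtain ⟨x₀, hux₀, hvx₀, hx₀⟩ := hux.exists_common hvx
  obtain ⟨x₁, h₀₁, hx₁⟩ := hx₀.exists_between
  obtain ⟨x₂, h₁₂, hx₂⟩ := hx₁.exists_between
  obtain ⟨u₁, hu₁, hu₁u⟩ := huu.exists_between
  obtain ⟨v₁, hv₁, hv₁v⟩ := hvv.exists_between
  obtain ⟨U, hU, hUx, huU, hxU⟩ :=
    hu.exists_full hdiv hO5 hu₁u (hux₀.le.trans (h₀₁.le.trans h₁₂.le)) h₁₂
  obtain ⟨V, hV, hVx, hvV, hxV⟩ :=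
    hv.exists_full hdiv hO5 hv₁v (hvx₀.le.trans (h₀₁.le.trans h₁₂.le)) h₁₂
  obtain ⟨p, h₀p, hp₁⟩ := h₀₁.exists_between
  obtain ⟨q, hpq, hq₁⟩ := hp₁.exists_between
  -- strongly soft `U₀ ≪ U₁ ≪ U` and `V₁ ≪ V`, generating an ideal containing `q`
  obtain ⟨U₂, hU₂, hqU₂⟩ := (hq₁.trans_le hxU).exists_infty
  obtain ⟨V₂, hV₂, hqV₂⟩ := (hq₁.trans_le hxV).exists_infty
  obtain ⟨U₀, huU₀, hU₂₀, hU₀⟩ := huU.exists_common hU₂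
  obtain ⟨U₁, hU₀₁, hU₁⟩ := hU₀.exists_between
  obtain ⟨V₀, hvV₀, hV₂₀, hV₀⟩ := hvV.exists_common hV₂
  obtain ⟨V₁, hV₁s, hV₀₁, hV₁⟩ := hV.exists_between hdiv hV₀
  have hqU₀ : q ≤ infty U₀ := hqU₂.le.trans (infty_mono hU₂₀.le)
  have hqV₁ : q ≤ infty V₁ := hqV₂.le.trans (infty_mono (hV₂₀.le.trans hV₀₁.le))
  obtain ⟨s₁, -, hUs, hUs₁⟩ := hU.exists_soft_add hdiv hU₁
  obtain ⟨s₂, -, hVs, hVs₂⟩ := hV.exists_soft_add hdiv hV₁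
  -- a common strongly soft remainder for `U₁` in `U` and `V₁` in `V`
  obtain ⟨z₁, hz₁q, hz₁s, hpz₁⟩ := hdiv.exists_le_le hO6 hO7 hpq
    (hqU₀.trans (infty_le_infty ((hU₀₁.le).trans hUs₁)))
  obtain ⟨z₁', hz₁', hx₀z₁⟩ := (h₀p.trans_le hpz₁).exists_infty
  obtain ⟨z, hzz₁, hzs₂, hzz⟩ := hdiv.exists_le_le hO6 hO7 hz₁'
    (hz₁q.trans (hqV₁.trans (infty_le_infty hVs₂)))
  have hx₀z : x₀ ≤ infty z := hx₀z₁.le.trans (infty_le_infty hzz)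
  obtain ⟨x₀', hux₀', hvx₀', hx₀'⟩ := (hu₁u.trans hux₀).exists_common (hv₁v.trans hvx₀)
  obtain ⟨s₀, hs₀, hs₀z, hxs₀⟩ := hdiv.exists_soft_of_infty (hx₀'.trans_le hx₀z)
  obtain ⟨x₀'', hux'', hvx'', hx₀''⟩ := hux₀'.exists_common hvx₀'
  obtain ⟨r, hr, hxr⟩ := (hx₀''.trans_le hxs₀).exists_infty
  obtain ⟨s', hs', hrs', hs's₀⟩ := hs₀.exists_between hdiv hr
  obtain ⟨s, hs's, hss₀⟩ := hs's₀.exists_between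
  have hsz : WayBelow s z := hss₀.trans_le hs₀z
  -- the complement of `s` dominates `u₁` and `v₁`
  have hsq : WayBelow s q := hsz.trans_le (hzz₁.trans hz₁q)
  have hxs' : x₀'' ≤ infty s' := hxr.le.trans (infty_mono hrs'.le)
  obtain ⟨c, hUc, hcx, hxc⟩ := hO5 s' s U₀ U₁ x₂ hs's hU₀₁ <| by
    rw [add_comm]
    exact (add_le_add le_rfl (hsz.le.trans (hzz₁.trans hz₁s))).trans (hUs.le.trans hUx)
  have hVc : WayBelow V₁ c := by
    refine hsep V₁ c s hV₁s ?_ (hsq.trans_le hqV₁)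
      (hsq.trans_le (hqU₀.trans (infty_mono hUc.le)))
    have h := WayBelow.le_trans (add_le_add le_rfl (hsz.le.trans hzs₂)) hVs
    exact h.trans_le (hVx.trans (hxc.trans (add_comm s c).le))
  obtain ⟨e, hue, hve, hec, he⟩ := hO7 u' u₁ v' v₁ c hu₁ (huU₀.le.trans hUc.le) hv₁
    (hvV₀.le.trans (hV₀₁.le.trans hVc.le))
  have hes : e ≤ e + s' := le_add_of_nonneg_right (CuSemigroup.zero_le _)
  refine ⟨e + s', hs'.add_left ?_, hue.trans_le hes, hve.trans_le hes, ?_⟩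
  · exact he.trans (add_le_infty (hux''.le.trans hxs') (hvx''.le.trans hxs'))
  · refine WayBelow.le_trans ?_ hx₂
    rw [add_comm]
    exact (add_le_add le_rfl hec).trans hcx

theorem StronglySoft.le_of_isLUB_Lset (hu : StronglySoft u) (hux : WayBelow u x)
    (hs : IsLUB (Lset x) y) : u ≤ y :=
  le_of_forall_wayBelow fun _ h => hs.1 ⟨u, hu, h, hux⟩

theorem StronglySoft.isLUB_Lset (hdiv : TwoOmegaDivisible S) (hu : StronglySoft u) :
    IsLUB (Lset u) u := by
  refine ⟨?_, fun b hb => le_of_forall_wayBelow fun w hw => ?_⟩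
  · rintro w ⟨v, -, hwv, hvu⟩
    exact hwv.le.trans hvu.le
  · obtain ⟨v, hv, hwv, hvu⟩ := hu.exists_between hdiv hw
    exact hb ⟨v, hv, hwv, hvu⟩

theorem stronglySoft_of_isLUB_Lset (hcb : CountablyBased S) (hsep : LeftSoftSeparative S)
    (hdiv : TwoOmegaDivisible S) (hO5 : SatisfiesO5 S) (hO6 : SatisfiesO6 S)
    (hO7 : SatisfiesO7 S) (hs : IsLUB (Lset x) y) : StronglySoft y := by
  obtain ⟨D, hD, hDS⟩ := hcb
  have hcof : ∀ w u, StronglySoft u → WayBelow w u → WayBelow u x → ∃ d ∈ D ∩ Lset x, w ≤ d := by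
    intro w u hu hwu hux
    obtain ⟨w₁, h₁, h₁u⟩ := hwu.exists_between
    obtain ⟨z, hz, hzD, hzl⟩ := hDS w₁
    obtain ⟨n, hn⟩ := h₁ z hz w₁ hzl le_rfl
    exact ⟨z n, ⟨hzD n, u, hu, WayBelow.le_trans (hzl.1 ⟨n, rfl⟩) h₁u, hux⟩, hn⟩
  let I := ↥(D ∩ Lset x)
  have : Countable I := (hD.mono inter_subset_left).to_subtype
  obtain ⟨_⟩ := nonempty_encodable I
  have : Nonempty I := by
    obtain ⟨d, hd, -⟩ := hcof 0 0 StronglySoft.zero (zero_wayBelow 0) (zero_wayBelow x)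
    exact ⟨⟨d, hd⟩⟩
  have := Classical.inhabited_of_nonempty this
  have hdir : Directed (· ≤ ·) (Subtype.val : I → S) := by
    rintro ⟨a, -, u, hu, hau, hux⟩ ⟨b, -, v, hv, hbv, hvx⟩
    obtain ⟨w, hw, haw, hbw, hwx⟩ :=
      hsep.exists_soft_common hdiv hO5 hO6 hO7 hu hv hau hux hbv hvx
    obtain ⟨w', haw', hbw', hw'⟩ := haw.exists_common hbw
    obtain ⟨d, hd, hwd⟩ := hcof w' w hw hw' hwx
    exact ⟨⟨d, hd⟩, haw'.le.trans hwd, hbw'.le.trans hwd⟩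
  let q : ℕ → I := hdir.sequence Subtype.val
  have hlub : IsLUB (range fun n => (q n).1) y := by
    refine ⟨?_, fun b hb => hs.2 ?_⟩
    · rintro _ ⟨n, rfl⟩
      exact hs.1 (q n).2.2
    · rintro a ⟨u, hu, hau, hux⟩
      obtain ⟨d, hd, had⟩ := hcof a u hu hau hux
      exact had.trans ((hdir.le_sequence ⟨d, hd⟩).trans (hb ⟨_, rfl⟩))
  intro w hw
  obtain ⟨w₁, h₁, h₁y⟩ := hw.exists_between
  obtain ⟨n, hn⟩ := h₁y _ hdir.sequence_mono _ hlub le_rfl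
  obtain ⟨u, hu, hdu, hux⟩ := (q n).2.2
  obtain ⟨t, ht, hwt⟩ := hu w (h₁.trans_le (hn.trans hdu.le))
  exact ⟨t, ht.trans_le (hu.le_of_isLUB_Lset hux hs), hwt⟩

theorem isLUB_of_isLUBIn {T : Set S} (hT : ∀ z : ℕ → S, Monotone z → (∀ n, z n ∈ T) →
    ∀ s, IsLUB (range z) s → s ∈ T) {z : ℕ → S} (hz : Monotone z) (hzT : ∀ n, z n ∈ T)
    (hx : IsLUBIn T (range z) x) : IsLUB (range z) x := by
  obtain ⟨s, hs⟩ := CuSemigroup.O1 z hz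
  exact ⟨hx.2.1, fun b hb => (hx.2.2 s (hT z hz hzT s hs) hs.1).trans (hs.2 hb)⟩

theorem WayBelow.wayBelowIn {T : Set S} (hT : ∀ z : ℕ → S, Monotone z → (∀ n, z n ∈ T) →
    ∀ s, IsLUB (range z) s → s ∈ T) (h : WayBelow x y) : WayBelowIn T x y :=
  fun z hz hzT s hs hy => h z hz s (isLUB_of_isLUBIn hT hz hzT hs) hy

theorem WayBelowIn.wayBelow (hdiv : TwoOmegaDivisible S) (hy : StronglySoft y)
    (h : WayBelowIn {x : S | StronglySoft x} x y) : WayBelow x y := by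
  obtain ⟨z, -, -, hb, hl⟩ := exists_wayBelow_seq y
  have hstep : ∀ (n : ℕ) (p : {w : S // StronglySoft w ∧ WayBelow w y}),
      ∃ q : {w : S // StronglySoft w ∧ WayBelow w y}, p.1 ≤ q.1 ∧ z n ≤ q.1 := by
    rintro n ⟨w, -, hw⟩
    obtain ⟨m, hwm, hzm, hm⟩ := hw.exists_common (hb n)
    obtain ⟨v, hv, hmv, hvy⟩ := hy.exists_between hdiv hm
    exact ⟨⟨v, hv, hvy⟩, hwm.le.trans hmv.le, hzm.le.trans hmv.le⟩
  choose g hg₁ hg₂ using hstep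
  let q : ℕ → {w : S // StronglySoft w ∧ WayBelow w y} :=
    Nat.rec ⟨0, StronglySoft.zero, zero_wayBelow y⟩ g
  obtain ⟨n, hn⟩ := h (fun n => (q n).1) (monotone_nat_of_le_succ fun n => hg₁ n (q n))
    (fun n => (q n).2.1) y
    ⟨hy, by rintro _ ⟨n, rfl⟩; exact (q n).2.2.le, fun b _ hbu => hl.2 (by
      rintro _ ⟨n, rfl⟩
      exact (hg₂ n (q n)).trans (hbu ⟨n + 1, rfl⟩))⟩ le_rfl
  exact WayBelow.le_trans hn (q n).2.2

end Soft

section Dimension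

variable [CuSemigroup S]

/-- The dimension of the strongly soft part is at most that of `S`. -/
theorem DimLe.dimLeOn_stronglySoft (hdiv : TwoOmegaDivisible S) {sigma : S → S}
    (hsoft : ∀ x, StronglySoft x ↔ sigma x = x) (hmem : ∀ x, StronglySoft (sigma x))
    (hle : ∀ x, sigma x ≤ x)
    (hadd : ∀ (r : ℕ) (y : Fin r → S), sigma (∑ j, y j) = ∑ j, sigma (y j))
    (hmono : Monotone sigma)
    (hT : ∀ z : ℕ → S, Monotone z → (∀ n, z n ∈ {x : S | StronglySoft x}) →
      ∀ s, IsLUB (range z) s → s ∈ {x : S | StronglySoft x})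
    {n : ℕ} (h : DimLe S n) : DimLeOn {x : S | StronglySoft x} n := by
  intro x' x hx' hx r y hy hxx hxy
  have hxx := hxx.wayBelow hdiv hx
  have hys : StronglySoft (∑ j, y j) := by
    rw [hsoft, hadd]
    exact Finset.sum_congr rfl fun j _ => (hsoft _).1 (hy j)
  have hxy := hxy.wayBelow hdiv hys
  obtain ⟨s, hs, hxs, hsx⟩ := StronglySoft.exists_between hdiv hx hxx
  obtain ⟨s', hs', hxs', hss⟩ := StronglySoft.exists_between hdiv hs hxs
  obtain ⟨z, hzy, hsz, hzs⟩ := h s' s r y hss (hsx.trans hxy)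
  refine ⟨fun j k => sigma (z j k), fun j k => hmem _,
    fun j k => (WayBelow.le_trans (hle _) (hzy j k)).wayBelowIn hT, ?_, fun k => ?_⟩
  · refine (hxs'.trans_le ?_).wayBelowIn hT
    have := hmono hsz.le
    rw [(hsoft _).1 hs'] at this
    simpa only [hadd] using this
  · refine (WayBelow.le_trans ?_ ((hzs k).trans hsx)).wayBelowIn hT
    exact Finset.sum_le_sum fun j _ => hle _

/-- The dimension of `S` exceeds that of its strongly soft part by at most one. -/
theorem DimLeOn.dimLe_succ (hdiv : TwoOmegaDivisible S) (hO6 : SatisfiesO6 S) {sigma : S → S}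
    (hsoft : ∀ x, StronglySoft x ↔ sigma x = x) (hmem : ∀ x, StronglySoft (sigma x))
    (hle : ∀ x, sigma x ≤ x)
    (hadd₂ : ∀ x y, sigma (x + y) = sigma x + sigma y)
    (hadd : ∀ (r : ℕ) (y : Fin r → S), sigma (∑ j, y j) = ∑ j, sigma (y j))
    (hmono : Monotone sigma)
    (hT : ∀ z : ℕ → S, Monotone z → (∀ n, z n ∈ {x : S | StronglySoft x}) →
      ∀ s, IsLUB (range z) s → s ∈ {x : S | StronglySoft x})
    {n : ℕ} (h : DimLeOn {x : S | StronglySoft x} n) : DimLe S (n + 1) := by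
  intro x' x r y hxx hxy
  obtain ⟨x₁, hx₁, hx₁x⟩ := hxx.exists_between
  obtain ⟨x₂, hx₁₂, hx₂⟩ := hx₁x.exists_between
  obtain ⟨s, hs, hsx, hxs⟩ := hdiv.exists_soft_pow r hx₁₂
  have hsx' : ∀ m ≤ 2 ^ r, m • s ≤ x₂ := fun m hm => (CuSemigroup.nsmul_mono s hm).trans hsx
  have hσ : x₁ + s = sigma x₁ + s := by
    rw [← (hsoft _).1 (hs.add_left hxs), hadd₂, (hsoft _).1 hs]
  have hx's : WayBelow x' (sigma x₁ + s) := by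
    rw [← hσ]
    exact hx₁.trans_le (le_add_of_nonneg_right (CuSemigroup.zero_le _))
  obtain ⟨u', s', hu', hs', hx'⟩ := hx's.exists_add
  obtain ⟨w', hw', hu'w, hw'x⟩ := (hmem x₁).exists_between hdiv hu'
  obtain ⟨w, hw, hw'w, hwx⟩ := (hmem x₁).exists_between hdiv hw'x
  have hwy : WayBelow w (∑ j, sigma (y j)) := by
    rw [← hadd]
    exact hwx.trans_le (hmono (hx₁x.trans hxy).le)
  obtain ⟨z, hz, hzy, hwz, hzw⟩ := h w' w hw' hw r (fun j => sigma (y j)) (fun j => hmem _)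
    (hw'w.wayBelowIn hT) (hwy.wayBelowIn hT)
  obtain ⟨s₁, hs₁, hs₁s⟩ := hs'.exists_between
  obtain ⟨s₂, hs₂, hs₂s⟩ := hs₁s.exists_between
  have hsy : WayBelow s₂ (∑ j, y j) := hs₂s.trans_le <| by
    have := (hsx' 1 Nat.one_le_two_pow).trans (hx₂.trans hxy).le
    simpa using this
  obtain ⟨v, hvs, hvy, hsv⟩ := exists_O6_sum hO6 hs₂ hsy
  obtain ⟨v', hv', hsv'⟩ := (hs₁.trans_le hsv).exists_sum
  have hz₁ : ∀ j k, WayBelow (z j k) (sigma (y j)) := fun j k =>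
    (hzy j k).wayBelow hdiv (hmem _)
  refine ⟨fun j => Fin.cons (v' j) (z j), fun j => Fin.cases ((hv' j).trans_le (hvy j))
    fun k => (hz₁ j k).trans_le (hle _), ?_, Fin.cases ?_ fun k => ?_⟩
  · refine hx'.trans_le ?_
    simp only [Fin.sum_univ_succ (n := n + 1), Fin.cons_zero, Fin.cons_succ,
      Finset.sum_add_distrib]
    rw [add_comm]
    have hsum : ∑ j, ∑ k, z j k = sigma (∑ j, ∑ k, z j k) := by
      simp only [hadd]
      exact Finset.sum_congr rfl fun j _ => Finset.sum_congr rfl fun k _ =>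
        ((hsoft _).1 (hz j k)).symm
    have hwz := hwz.wayBelow hdiv ((hsoft _).2 hsum.symm)
    exact add_le_add hsv'.le (hu'w.le.trans hwz.le)
  · refine WayBelow.le_trans ?_ hx₂
    calc ∑ j, v' j ≤ ∑ _j : Fin r, s :=
          Finset.sum_le_sum fun j _ => (hv' j).le.trans ((hvs j).trans hs₂s.le)
      _ = r • s := by simp
      _ ≤ x₂ := hsx' r Nat.lt_two_pow_self.le
  · exact ((hzw k).wayBelow hdiv hw).trans
      (hwx.trans_le ((hle _).trans hx₁x.le))

end Dimension

/-- In a countably based, left-soft separative, (2,ω)-divisible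
Cu-semigroup satisfying (O5)-(O7) for which `σ : S → S_soft` is a generalized
Cu-morphism, one has `dim(S_soft) ≤ dim(S) ≤ dim(S_soft) + 1`. -/
theorem dim_soft_estimate {S : Type*} [CuSemigroup S]
    (hcb : CountablyBased S) (hsep : LeftSoftSeparative S)
    (hdiv : TwoOmegaDivisible S)
    (hO5 : SatisfiesO5 S) (hO6 : SatisfiesO6 S) (hO7 : SatisfiesO7 S)
    (sigma : S → S) (hsigma : ∀ x : S, IsLUB (Lset x) (sigma x))
    (hzero : sigma 0 = 0)
    (hadd : ∀ x y : S, sigma (x + y) = sigma x + sigma y)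
    (hmono : ∀ x y : S, x ≤ y → sigma x ≤ sigma y)
    (hsup : ∀ z : ℕ → S, Monotone z → ∀ s : S, IsLUB (Set.range z) s →
      IsLUB (Set.range fun n => sigma (z n)) (sigma s)) :
    cuDimOn {x : S | StronglySoft x} ≤ cuDim S ∧
    cuDim S ≤ cuDimOn {x : S | StronglySoft x} + 1 := by
  have hmem : ∀ x, StronglySoft (sigma x) := fun x =>
    stronglySoft_of_isLUB_Lset hcb hsep hdiv hO5 hO6 hO7 (hsigma x)
  have hsoft : ∀ x, StronglySoft x ↔ sigma x = x := fun x =>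
    ⟨fun hx => (hsigma x).unique (hx.isLUB_Lset hdiv), fun hx => hx ▸ hmem x⟩
  have hle : ∀ x, sigma x ≤ x := fun x => (hsigma x).2 <| by
    rintro w ⟨u, -, hwu, hux⟩
    exact hwu.le.trans hux.le
  have hsum : ∀ (r : ℕ) (y : Fin r → S), sigma (∑ j, y j) = ∑ j, sigma (y j) := fun r y =>
    map_sum (AddMonoidHom.mk ⟨sigma, hzero⟩ hadd) y Finset.univ
  have hT : ∀ z : ℕ → S, Monotone z → (∀ n, z n ∈ {x : S | StronglySoft x}) →
      ∀ s, IsLUB (range z) s → s ∈ {x : S | StronglySoft x} := by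
    intro z hz hzT s hs
    have h := hsup z hz s hs
    simp only [fun n => (hsoft _).1 (hzT n)] at h
    exact (hsoft s).2 (h.unique hs)
  constructor
  · exact le_iInf₂ fun n hn => iInf₂_le n
      (DimLe.dimLeOn_stronglySoft hdiv hsoft hmem hle hsum @hmono hT hn)
  · unfold cuDimOn
    rw [ENat.iInf_add]
    refine le_iInf fun n => ?_
    rw [ENat.iInf_add]
    refine le_iInf fun hn => ?_
    exact iInf₂_le (n + 1)
      (DimLeOn.dimLe_succ hdiv hO6 hsoft hmem hle hadd hsum @hmono hT hn)
end
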